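/- arXiv:1307.7089 — 2 statements merged into one kernel-verified Lean document; each statement's English description precedes it below -/
import Mathlib

section
/- Let G be a finite simple graph on an even number of vertices, let M1 be a perfect matching of G, and let C be a 2-matching of G such that no edge of M1 is an edge of C. Then the edge set of C can be partitioned into four matchings X0, X1, X2, X3 such that for every j in {0, 1, 2, 3}, the graph with edge set M1 ∪ Xj is an acyclic 2-matching of G. -/
/-- A set of edges is a matching: each edge is non-diagonal (joins two distinct
vertices) and no two distinct edges share a vertex. -/
def IsMatchingSet {V : Type*} (M : Finset (Sym2 V)) : Prop :=
  (∀ e ∈ M, ¬ e.IsDiag) ∧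
    ∀ e ∈ M, ∀ f ∈ M, e ≠ f → ∀ v : V, v ∈ e → v ∉ f

/-- A set of edges is a perfect matching: a matching covering every vertex. -/
def IsPerfectMatchingSet {V : Type*} (M : Finset (Sym2 V)) : Prop :=
  IsMatchingSet M ∧ ∀ v : V, ∃ e ∈ M, v ∈ e

/-- A set of edges is a 2-matching: each edge is non-diagonal and every vertex
is incident to at most two of the edges. -/
def IsTwoMatchingSet {V : Type*} [DecidableEq V] (C : Finset (Sym2 V)) : Prop :=
  (∀ e ∈ C, ¬ e.IsDiag) ∧
    ∀ v : V, (C.filter (fun e => v ∈ e)).card ≤ 2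

/-- A set of edges is an acyclic 2-matching: a 2-matching whose associated graph
contains no cycle, i.e. it is a vertex-disjoint union of paths. -/
def IsAcyclicTwoMatchingSet {V : Type*} [DecidableEq V] (C : Finset (Sym2 V)) : Prop :=
  IsTwoMatchingSet C ∧ (SimpleGraph.fromEdgeSet (↑C : Set (Sym2 V))).IsAcyclic

namespace SimpleGraph

/-- In a finite connected graph of maximum degree at most two, at most two vertices
have degree at most one. -/
lemma Connected.not_three_endpoints {W : Type*} [Finite W] {D : SimpleGraph W}
    (hD : D.Connected)
    (h2 : ∀ v a b c, D.Adj v a → D.Adj v b → D.Adj v c → a = b ∨ a = c ∨ b = c)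
    {x y z : W} (hxy : x ≠ y) (hxz : x ≠ z) (hyz : y ≠ z)
    (h1 : ∀ v, v = x ∨ v = y ∨ v = z → ∀ a b, D.Adj v a → D.Adj v b → a = b) : False := by
  classical
  have := Fintype.ofFinite W
  have hcard := hD.card_vert_le_card_edgeSet_add_one
  rw [Nat.card_eq_fintype_card, Nat.card_eq_fintype_card, ← edgeFinset_card] at hcard
  have hsum := D.sum_degrees_eq_twice_card_edges
  have hdeg : ∀ v, D.degree v + (if v ∈ ({x, y, z} : Finset W) then 1 else 0) ≤ 2 := by
    intro v
    split_ifs with hv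
    · have : D.degree v ≤ 1 := Finset.card_le_one.2 fun a ha b hb =>
        h1 v (by simpa using hv) a b (by simpa using ha) (by simpa using hb)
      omega
    · by_contra hlt
      obtain ⟨a, b, c, ha, hb, hc, hab, hac, hbc⟩ :=
        Finset.two_lt_card_iff.1 (show 2 < (D.neighborFinset v).card by
          rw [card_neighborFinset_eq_degree]; omega)
      have := h2 v a b c (by simpa using ha) (by simpa using hb) (by simpa using hc)
      tauto
  have htotal := Finset.sum_le_sum fun v (_ : v ∈ Finset.univ) => hdeg v
  have hthree : ({x, y, z} : Finset W).card = 3 := Finset.card_eq_three.2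
    ⟨x, y, z, hxy, hxz, hyz, rfl⟩
  rw [Finset.sum_add_distrib, Finset.sum_ite_mem, Finset.univ_inter, Finset.sum_const,
    Finset.sum_const, hthree, hsum, Finset.card_univ] at htotal
  simp only [smul_eq_mul] at htotal
  omega

/-- In a finite graph of maximum degree at most two, no three distinct vertices of degree
at most one lie in the same component. -/
lemma not_reachable_three_endpoints {V : Type*} [Finite V] {G : SimpleGraph V}
    (h2 : ∀ v a b c, G.Adj v a → G.Adj v b → G.Adj v c → a = b ∨ a = c ∨ b = c)
    {x y z : V} (hxy : x ≠ y) (hxz : x ≠ z) (hyz : y ≠ z)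
    (h1 : ∀ v, v = x ∨ v = y ∨ v = z → ∀ a b, G.Adj v a → G.Adj v b → a = b)
    (hy : G.Reachable x y) (hz : G.Reachable x z) : False := by
  have hC := (G.connectedComponentMk x).connected_toSimpleGraph
  refine hC.not_three_endpoints (x := ⟨x, rfl⟩) (y := ⟨y, ConnectedComponent.sound hy.symm⟩)
    (z := ⟨z, ConnectedComponent.sound hz.symm⟩) ?_ (mt (congrArg Subtype.val) hxy)
    (mt (congrArg Subtype.val) hxz) (mt (congrArg Subtype.val) hyz) ?_
  · rintro ⟨v, _⟩ ⟨a, _⟩ ⟨b, _⟩ ⟨c, _⟩ ha hb hc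
    simpa using h2 v a b c ha hb hc
  · rintro ⟨v, _⟩ hv ⟨a, _⟩ ⟨b, _⟩ ha hb
    simpa using h1 v (hv.imp (congrArg Subtype.val) (Or.imp (congrArg Subtype.val)
      (congrArg Subtype.val))) a b ha hb

end SimpleGraph

section Colouring

variable {V : Type*}

lemma IsMatchingSet.eq_of_mem {M : Finset (Sym2 V)} (hM : IsMatchingSet M) {v a b : V}
    (ha : s(v, a) ∈ M) (hb : s(v, b) ∈ M) : a = b := by
  by_contra hab
  exact hM.2 _ ha _ hb (mt Sym2.congr_right.1 hab) v (by simp) (by simp)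

lemma IsMatchingSet.ne_of_mem {M : Finset (Sym2 V)} (hM : IsMatchingSet M) {a b : V}
    (h : s(a, b) ∈ M) : a ≠ b := by
  simpa using hM.1 _ h

lemma IsMatchingSet.mono {M N : Finset (Sym2 V)} (hN : IsMatchingSet N) (h : M ⊆ N) :
    IsMatchingSet M :=
  ⟨fun e he => hN.1 e (h he), fun e he f hf => hN.2 e (h he) f (h hf)⟩

lemma IsPerfectMatchingSet.exists_mate {M : Finset (Sym2 V)} (hM : IsPerfectMatchingSet M)
    (v : V) : ∃ w, s(v, w) ∈ M := by
  obtain ⟨e, he, hv⟩ := hM.2 v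
  obtain ⟨w, rfl⟩ := Sym2.mem_iff_exists.1 hv
  exact ⟨w, he⟩

lemma IsMatchingSet.isAcyclic {M : Finset (Sym2 V)} (hM : IsMatchingSet M) :
    (SimpleGraph.fromEdgeSet (M : Set (Sym2 V))).IsAcyclic := by
  intro v c hc
  have h1 := c.adj_snd hc.not_nil
  have h2 := (c.adj_penultimate hc.not_nil).symm
  rw [SimpleGraph.fromEdgeSet_adj] at h1 h2
  exact hc.snd_ne_penultimate (hM.eq_of_mem h1.1 h2.1)

variable [DecidableEq V]

lemma IsTwoMatchingSet.mono {C D : Finset (Sym2 V)} (hD : IsTwoMatchingSet D) (h : C ⊆ D) :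
    IsTwoMatchingSet C :=
  ⟨fun e he => hD.1 e (h he), fun v =>
    (Finset.card_le_card (Finset.filter_subset_filter _ h)).trans (hD.2 v)⟩

lemma IsTwoMatchingSet.eq_of_mem {C : Finset (Sym2 V)} (hC : IsTwoMatchingSet C) {v a b c : V}
    (ha : s(v, a) ∈ C) (hb : s(v, b) ∈ C) (hc : s(v, c) ∈ C) : a = b ∨ a = c ∨ b = c := by
  by_contra! h
  refine (Finset.two_lt_card_iff.2 ⟨s(v, a), s(v, b), s(v, c), ?_⟩).not_ge (hC.2 v)
  simp only [Finset.mem_filter, ha, hb, hc, Sym2.mem_mk_left, ne_eq, Sym2.congr_right, h,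
    not_false_eq_true, and_self]

lemma IsMatchingSet.isTwoMatchingSet_union {M N : Finset (Sym2 V)} (hM : IsMatchingSet M)
    (hN : IsMatchingSet N) : IsTwoMatchingSet (M ∪ N) := by
  have key : ∀ {K : Finset (Sym2 V)}, IsMatchingSet K → ∀ v : V,
      (K.filter (fun e => v ∈ e)).card ≤ 1 := by
    intro K hK v
    refine Finset.card_le_one.2 fun e he f hf => ?_
    rw [Finset.mem_filter] at he hf
    by_contra hne
    exact hK.2 e he.1 f hf.1 hne v he.2 hf.2
  refine ⟨fun e he => (Finset.mem_union.1 he).elim (hM.1 e) (hN.1 e), fun v => ?_⟩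
  rw [Finset.filter_union]
  exact (Finset.card_union_le _ _).trans (Nat.add_le_add (key hM v) (key hN v))

/-- A matching `X` is compatible with `M` if the graph with edge set `M ∪ X` is acyclic. -/
def IsCompatibleMatching (M X : Finset (Sym2 V)) : Prop :=
  IsMatchingSet X ∧ (SimpleGraph.fromEdgeSet (↑(M ∪ X) : Set (Sym2 V))).IsAcyclic

/-- `IsFreePair M X u v`: adding the edge `uv` to `X` creates neither a vertex incident to two
edges of `X` nor a cycle in `M ∪ X`. -/
def IsFreePair (M X : Finset (Sym2 V)) (u v : V) : Prop :=
  (∀ x, s(u, x) ∉ X) ∧ (∀ x, s(v, x) ∉ X) ∧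
    ¬ (SimpleGraph.fromEdgeSet (↑(M ∪ X) : Set (Sym2 V))).Reachable u v

lemma fromEdgeSet_union_mono {M X Y : Finset (Sym2 V)} (h : X ⊆ Y) :
    SimpleGraph.fromEdgeSet (↑(M ∪ X) : Set (Sym2 V)) ≤
      SimpleGraph.fromEdgeSet (↑(M ∪ Y) : Set (Sym2 V)) :=
  SimpleGraph.fromEdgeSet_mono (by exact_mod_cast Finset.union_subset_union_right h)

lemma IsCompatibleMatching.mono {M X Y : Finset (Sym2 V)} (hY : IsCompatibleMatching M Y)
    (h : X ⊆ Y) : IsCompatibleMatching M X :=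
  ⟨hY.1.mono h, hY.2.anti (fromEdgeSet_union_mono h)⟩

lemma IsFreePair.mono {M X Y : Finset (Sym2 V)} {u v : V} (hY : IsFreePair M Y u v)
    (h : X ⊆ Y) : IsFreePair M X u v :=
  ⟨fun x hx => hY.1 x (h hx), fun x hx => hY.2.1 x (h hx),
    fun hr => hY.2.2 (hr.mono (fromEdgeSet_union_mono h))⟩

lemma IsCompatibleMatching.insert_edge {M X : Finset (Sym2 V)} {u v : V}
    (hX : IsCompatibleMatching M X) (huv : IsFreePair M X u v) :
    IsCompatibleMatching M (insert s(u, v) X) := by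
  obtain ⟨hu, hv, hr⟩ := huv
  have hne : u ≠ v := by rintro rfl; exact hr (SimpleGraph.Reachable.refl _)
  have hnew : ∀ f ∈ X, ∀ w, w ∈ s(u, v) → w ∉ f := by
    intro f hf w hw hwf
    obtain ⟨x, rfl⟩ := Sym2.mem_iff_exists.1 hwf
    rcases Sym2.mem_iff.1 hw with rfl | rfl
    · exact hu x hf
    · exact hv x hf
  refine ⟨⟨?_, ?_⟩, ?_⟩
  · intro e he
    rcases Finset.mem_insert.1 he with rfl | he
    · simpa using hne
    · exact hX.1.1 e he
  · intro e he f hf hef w hwe hwf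
    rcases Finset.mem_insert.1 he with rfl | he <;> rcases Finset.mem_insert.1 hf with rfl | hf
    · exact hef rfl
    · exact hnew f hf w hwe hwf
    · exact hnew e he w hwf hwe
    · exact hX.1.2 e he f hf hef w hwe hwf
  · refine (SimpleGraph.IsAcyclic.sup_edge_of_not_reachable hr hX.2).anti ?_
    rw [SimpleGraph.edge, ← SimpleGraph.fromEdgeSet_union]
    refine SimpleGraph.fromEdgeSet_mono ?_
    intro e he
    simp only [Finset.coe_union, Finset.coe_insert, Set.mem_union, Set.mem_insert_iff,
      Set.mem_singleton_iff] at he ⊢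
    tauto

/-- If `uw ∈ M` and no edge of `X` meets `u` or `w`, then `{u, w}` is a component of `M ∪ X`. -/
lemma IsMatchingSet.eq_or_eq_of_reachable {M X : Finset (Sym2 V)} (hM : IsMatchingSet M)
    {u w y : V} (huw : s(u, w) ∈ M) (hu : ∀ x, s(u, x) ∉ X) (hw : ∀ x, s(w, x) ∉ X)
    (hr : (SimpleGraph.fromEdgeSet (↑(M ∪ X) : Set (Sym2 V))).Reachable u y) :
    y = u ∨ y = w := by
  rw [SimpleGraph.reachable_iff_reflTransGen] at hr
  induction hr with
  | refl => exact Or.inl rfl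
  | @tail b c _ hbc ih =>
    rw [SimpleGraph.fromEdgeSet_adj, Finset.mem_coe, Finset.mem_union] at hbc
    rcases ih with rfl | rfl
    · exact Or.inr (hM.eq_of_mem (hbc.1.resolve_right (hu c)) huw)
    · exact Or.inl (hM.eq_of_mem (hbc.1.resolve_right (hw c)) (Sym2.eq_swap ▸ huw))

/-- If `u` and `v` are joined in `M ∪ X` but not matched to each other, and no edge of `X` meets
`u`, then an edge of `X` meets the `M`-mate of `u`. -/
lemma IsMatchingSet.exists_mem_of_reachable {M X : Finset (Sym2 V)} (hM : IsMatchingSet M)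
    {u v w : V} (huw : s(u, w) ∈ M) (hne : u ≠ v) (huv : s(u, v) ∉ M) (hu : ∀ x, s(u, x) ∉ X)
    (hr : (SimpleGraph.fromEdgeSet (↑(M ∪ X) : Set (Sym2 V))).Reachable u v) :
    ∃ x, s(w, x) ∈ X := by
  by_contra! hw
  rcases hM.eq_or_eq_of_reachable huw hu hw hr with rfl | rfl
  · exact hne rfl
  · exact huv huw

/-- Three distinct vertices missed by the matching `X` do not lie in one component of `M ∪ X`. -/
lemma IsMatchingSet.not_reachable_three [Finite V] {M X : Finset (Sym2 V)}
    (hM : IsMatchingSet M) (hX : IsMatchingSet X) {x y z : V}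
    (hxy : x ≠ y) (hxz : x ≠ z) (hyz : y ≠ z)
    (hx : ∀ a, s(x, a) ∉ X) (hy : ∀ a, s(y, a) ∉ X) (hz : ∀ a, s(z, a) ∉ X)
    (hry : (SimpleGraph.fromEdgeSet (↑(M ∪ X) : Set (Sym2 V))).Reachable x y)
    (hrz : (SimpleGraph.fromEdgeSet (↑(M ∪ X) : Set (Sym2 V))).Reachable x z) : False := by
  refine SimpleGraph.not_reachable_three_endpoints ?_ hxy hxz hyz ?_ hry hrz
  · intro v a b c ha hb hc
    simp only [SimpleGraph.fromEdgeSet_adj, Finset.mem_coe] at ha hb hc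
    exact (hM.isTwoMatchingSet_union hX).eq_of_mem ha.1 hb.1 hc.1
  · intro v hv a b ha hb
    have hvX : ∀ a, s(v, a) ∉ X := by rcases hv with rfl | rfl | rfl <;> assumption
    simp only [SimpleGraph.fromEdgeSet_adj, Finset.mem_coe, Finset.mem_union, hvX,
      or_false] at ha hb
    exact hM.eq_of_mem ha.1 hb.1

/-- Every colour class of `C` under `col` is a matching compatible with `M`. -/
def IsGoodColouring (M C : Finset (Sym2 V)) (col : Sym2 V → Fin 4) : Prop :=
  ∀ j, IsCompatibleMatching M (C.filter (fun e => col e = j))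

lemma IsGoodColouring.mono {M C D : Finset (Sym2 V)} {col : Sym2 V → Fin 4}
    (hD : IsGoodColouring M D col) (h : C ⊆ D) : IsGoodColouring M C col :=
  fun j => (hD j).mono (Finset.filter_subset_filter _ h)

lemma IsGoodColouring.insert_edge {M C : Finset (Sym2 V)} {col : Sym2 V → Fin 4} {u v : V} {j : Fin 4}
    (hC : IsGoodColouring M C col)
    (huv : IsFreePair M (C.filter (fun e => col e = j)) u v) :
    IsGoodColouring M (insert s(u, v) C) (Function.update col s(u, v) j) := by
  intro i
  by_cases hij : i = j
  · subst hij
    refine ((hC i).insert_edge huv).mono fun e he => ?_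
    simp only [Finset.mem_filter, Finset.mem_insert, Function.update_apply] at he ⊢
    grind
  · refine (hC i).mono fun e he => ?_
    simp only [Finset.mem_filter, Finset.mem_insert, Function.update_apply] at he ⊢
    grind

/-- Two fresh colours `c`, `d` and two further colours `a`, `b`. -/
lemma exists_four_colours (a a' : Fin 4) :
    ∃ b c d : Fin 4, b ≠ a ∧ b ≠ c ∧ b ≠ d ∧ c ≠ a ∧ d ≠ a ∧ c ≠ a' ∧ d ≠ a' ∧ c ≠ d := by
  revert a a'
  decide

lemma exists_colour_at_endpoint {C : Finset (Sym2 V)} {col : Sym2 V → Fin 4} {u v : V}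
    (hC : IsTwoMatchingSet (insert s(u, v) C)) (huv : s(u, v) ∉ C) :
    ∃ a, ∀ x, s(u, x) ∈ C → col s(u, x) = a := by
  by_cases h : ∃ x, s(u, x) ∈ C
  · obtain ⟨x, hx⟩ := h
    refine ⟨col s(u, x), fun y hy => ?_⟩
    rcases hC.eq_of_mem (Finset.mem_insert_self _ _) (Finset.mem_insert_of_mem hx)
      (Finset.mem_insert_of_mem hy) with h | h | h
    · exact absurd (h ▸ hx) huv
    · exact absurd (h ▸ hy) huv
    · rw [h]
  · push Not at h
    exact ⟨0, fun x hx => absurd hx (h x)⟩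

lemma IsTwoMatchingSet.not_mem_of_colours {C : Finset (Sym2 V)} (hC : IsTwoMatchingSet C)
    {col : Sym2 V → Fin 4} {v x y z : V} (hx : s(v, x) ∈ C) (hy : s(v, y) ∈ C)
    (hxy : col s(v, x) ≠ col s(v, y)) (hxz : col s(v, x) ≠ col s(v, z))
    (hyz : col s(v, y) ≠ col s(v, z)) : s(v, z) ∉ C := by
  intro hz
  rcases hC.eq_of_mem hx hy hz with rfl | rfl | rfl <;> contradiction

/-- Swapping: the edge `wx` of colour `c` gives its colour to the uncoloured edge `uv` and
receives the colour `b` instead, where `w` is the `M`-mate of `u`. -/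
lemma IsGoodColouring.exchange {M C : Finset (Sym2 V)} {col : Sym2 V → Fin 4} {u v w x : V}
    {b c : Fin 4} (hM : IsMatchingSet M) (hC : IsGoodColouring M C col) (huw : s(u, w) ∈ M)
    (huv : s(u, v) ∉ M) (hne : u ≠ v) (hbc : b ≠ c)
    (hu : ∀ y, s(u, y) ∉ C.filter (fun e => col e = c))
    (hv : ∀ y, s(v, y) ∉ C.filter (fun e => col e = c))
    (hx : s(w, x) ∈ C.filter (fun e => col e = c))
    (hfree : IsFreePair M (C.filter (fun e => col e = b)) w x) :
    ∃ col', IsGoodColouring M (insert s(u, v) C) col' := by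
  have h1 : IsGoodColouring M (insert s(w, x) (C.erase s(w, x)))
      (Function.update col s(w, x) b) :=
    (hC.mono (Finset.erase_subset _ _)).insert_edge
      (hfree.mono (Finset.filter_subset_filter _ (Finset.erase_subset _ _)))
  rw [Finset.insert_erase (Finset.mem_filter.1 hx).1] at h1
  have hsub : C.filter (fun e => Function.update col s(w, x) b e = c) ⊆
      (C.filter (fun e => col e = c)).erase s(w, x) := by
    intro e he
    simp only [Finset.mem_filter, Finset.mem_erase, Function.update_apply] at he ⊢
    grind
  refine ⟨_, h1.insert_edge (j := c) (IsFreePair.mono ⟨?_, ?_, ?_⟩ hsub)⟩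
  · exact fun y hy => hu y (Finset.mem_of_mem_erase hy)
  · exact fun y hy => hv y (Finset.mem_of_mem_erase hy)
  · intro hr
    obtain ⟨y, hy⟩ := hM.exists_mem_of_reachable huw hne huv
      (fun y hy => hu y (Finset.mem_of_mem_erase hy)) hr
    obtain rfl := (hC c).1.eq_of_mem hx (Finset.mem_of_mem_erase hy)
    exact Finset.notMem_erase _ _ hy

/-- A good colouring extends, possibly after recolouring one edge, to one further edge. -/
lemma IsGoodColouring.exists_insert [Finite V] {M C : Finset (Sym2 V)} {col : Sym2 V → Fin 4}
    {u v : V} (hM : IsPerfectMatchingSet M) (hcol : IsGoodColouring M C col)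
    (huvC : s(u, v) ∉ C) (hC : IsTwoMatchingSet (insert s(u, v) C))
    (hdisj : Disjoint M (insert s(u, v) C)) :
    ∃ col', IsGoodColouring M (insert s(u, v) C) col' := by
  have hne : u ≠ v := by simpa using hC.1 _ (Finset.mem_insert_self _ _)
  have huvM : s(u, v) ∉ M := fun h =>
    Finset.disjoint_left.1 hdisj h (Finset.mem_insert_self _ _)
  have hC' : IsTwoMatchingSet C := hC.mono (Finset.subset_insert _ _)
  by_cases hex : ∃ j, IsFreePair M (C.filter (fun e => col e = j)) u v
  · obtain ⟨j, hj⟩ := hex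
    exact ⟨_, hcol.insert_edge hj⟩
  push Not at hex
  obtain ⟨w, huw⟩ := hM.exists_mate u
  have hwu : s(w, u) ∈ M := Sym2.eq_swap ▸ huw
  obtain ⟨a, ha⟩ := exists_colour_at_endpoint (col := col) hC huvC
  obtain ⟨a', ha'⟩ := exists_colour_at_endpoint (col := col) (u := v) (v := u)
    (by rwa [Sym2.eq_swap]) (by rwa [Sym2.eq_swap])
  obtain ⟨b, c, d, hba, hbc, hbd, hca, hda, hca', hda', hcd⟩ := exists_four_colours a a'
  have hu : ∀ j, j ≠ a → ∀ y, s(u, y) ∉ C.filter (fun e => col e = j) := by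
    intro j hj y hy
    rw [Finset.mem_filter] at hy
    exact hj (hy.2.symm.trans (ha y hy.1))
  have hv : ∀ j, j ≠ a' → ∀ y, s(v, y) ∉ C.filter (fun e => col e = j) := by
    intro j hj y hy
    rw [Finset.mem_filter] at hy
    exact hj (hy.2.symm.trans (ha' y hy.1))
  have hwex : ∀ j, j ≠ a → j ≠ a' → ∃ x, s(w, x) ∈ C.filter (fun e => col e = j) := by
    intro j hj hj'
    refine hM.1.exists_mem_of_reachable huw hne huvM (hu j hj) ?_
    by_contra hr
    exact hex j ⟨hu j hj, hv j hj', hr⟩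
  obtain ⟨x, hx⟩ := hwex c hca hca'
  obtain ⟨y, hy⟩ := hwex d hda hda'
  have hw : ∀ j, j ≠ c → j ≠ d → ∀ z, s(w, z) ∉ C.filter (fun e => col e = j) := by
    intro j hjc hjd z hz
    rw [Finset.mem_filter] at hx hy hz
    exact hC'.not_mem_of_colours (col := col) hx.1 hy.1 (by rw [hx.2, hy.2]; exact hcd)
      (by rw [hx.2, hz.2]; exact hjc.symm) (by rw [hy.2, hz.2]; exact hjd.symm) hz.1
  by_contra hcon
  -- Each of the two edges at `w` ends in a vertex missed by `a` and joined to `w` in colour `a`.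
  have key : ∀ j z, j ≠ a → j ≠ a' → j ≠ b → s(w, z) ∈ C.filter (fun e => col e = j) →
      (∀ t, s(w, t) ∉ C.filter (fun e => col e = a)) →
      (∀ t, s(w, t) ∉ C.filter (fun e => col e = b)) →
      w ≠ z ∧ (∀ t, s(z, t) ∉ C.filter (fun e => col e = a)) ∧
        (SimpleGraph.fromEdgeSet
          (↑(M ∪ C.filter (fun e => col e = a)) : Set (Sym2 V))).Reachable w z := by
    intro j z hja hja' hjb hz hwa hwb
    have hwz : w ≠ z := (hcol j).1.ne_of_mem hz
    have hzC := Finset.mem_filter.1 hz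
    have hwzM : s(w, z) ∉ M := fun h =>
      Finset.disjoint_left.1 hdisj h (Finset.mem_insert_of_mem hzC.1)
    have hnot : ∀ i, i ≠ j → ¬ IsFreePair M (C.filter (fun e => col e = i)) w z :=
      fun i hi hfree => hcon
        (hcol.exchange hM.1 huw huvM hne hi (hu j hja) (hv j hja') hz hfree)
    have hzb : ∃ t, s(z, t) ∈ C.filter (fun e => col e = b) := by
      by_contra! hzb
      refine hnot b hjb.symm ⟨hwb, hzb, fun hr => ?_⟩
      obtain ⟨t, ht⟩ := hM.1.exists_mem_of_reachable hwu hwz hwzM hwb hr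
      exact hu b hba t ht
    obtain ⟨t, ht⟩ := hzb
    rw [Finset.mem_filter] at ht
    have hza : ∀ t, s(z, t) ∉ C.filter (fun e => col e = a) := by
      intro t' ht'
      rw [Finset.mem_filter] at ht'
      have hzw : s(z, w) ∈ C ∧ col s(z, w) = j := by rwa [Sym2.eq_swap]
      exact hC'.not_mem_of_colours (col := col) hzw.1 ht.1 (by rw [hzw.2, ht.2]; exact hjb)
        (by rw [hzw.2, ht'.2]; exact hja) (by rw [ht.2, ht'.2]; exact hba) ht'.1
    refine ⟨hwz, hza, ?_⟩
    by_contra hr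
    exact hnot a hja.symm ⟨hwa, hza, hr⟩
  have hwa := hw a hca.symm hda.symm
  have hwb := hw b hbc hbd
  obtain ⟨hwx, hxa, hrx⟩ := key c x hca hca' hbc.symm hx hwa hwb
  obtain ⟨hwy, hya, hry⟩ := key d y hda hda' hbd.symm hy hwa hwb
  have hxy : x ≠ y := by
    rintro rfl
    exact hcd ((Finset.mem_filter.1 hx).2.symm.trans (Finset.mem_filter.1 hy).2)
  exact hM.1.not_reachable_three (hcol a).1 hwx hwy hxy hwa hxa hya hrx hry

lemma exists_isGoodColouring [Finite V] {M : Finset (Sym2 V)} (hM : IsPerfectMatchingSet M)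
    (C : Finset (Sym2 V)) (hC : IsTwoMatchingSet C) (hdisj : Disjoint M C) :
    ∃ col, IsGoodColouring M C col := by
  induction C using Finset.induction_on with
  | empty =>
    refine ⟨fun _ => 0, fun j => ⟨⟨by simp, by simp⟩, ?_⟩⟩
    simpa using hM.1.isAcyclic
  | insert e C he ih =>
    obtain ⟨col, hcol⟩ := ih (hC.mono (Finset.subset_insert _ _))
      (hdisj.mono_right (Finset.subset_insert _ _))
    induction e using Sym2.ind with
    | _ u v => exact hcol.exists_insert hM he hC hdisj

end Colouring

/-- If `M1` is a perfect matching of a finite simple graph `G` on an even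
number of vertices and `C` is a 2-matching of `G` sharing no edge with `M1`, then the
edge set of `C` can be partitioned into four matchings `X 0, X 1, X 2, X 3` such that
each `M1 ∪ X j` is an acyclic 2-matching of `G`. -/
theorem stmt1 {V : Type*} [Fintype V] [DecidableEq V]
    (hV : Even (Fintype.card V)) (G : SimpleGraph V)
    (M1 : Finset (Sym2 V)) (hM1 : IsPerfectMatchingSet M1)
    (hM1G : (↑M1 : Set (Sym2 V)) ⊆ G.edgeSet)
    (C : Finset (Sym2 V)) (hC : IsTwoMatchingSet C)
    (hCG : (↑C : Set (Sym2 V)) ⊆ G.edgeSet)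
    (hdisj : Disjoint M1 C) :
    ∃ X : Fin 4 → Finset (Sym2 V),
      (∀ i j, i ≠ j → Disjoint (X i) (X j)) ∧
      (X 0 ∪ X 1 ∪ X 2 ∪ X 3 = C) ∧
      ∀ j : Fin 4, IsMatchingSet (X j) ∧
        (↑(M1 ∪ X j) : Set (Sym2 V)) ⊆ G.edgeSet ∧
        IsAcyclicTwoMatchingSet (M1 ∪ X j) := by
  obtain ⟨col, hcol⟩ := exists_isGoodColouring hM1 C hC hdisj
  refine ⟨fun j => C.filter (fun e => col e = j), fun i j hij => ?_, ?_, fun j => ?_⟩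
  · refine Finset.disjoint_left.2 fun e hi hj => hij ?_
    exact (Finset.mem_filter.1 hi).2.symm.trans (Finset.mem_filter.1 hj).2
  · ext e
    simp only [Finset.mem_union, Finset.mem_filter, ← and_or_left, and_iff_left_iff_imp]
    intro _
    generalize col e = k
    revert k
    decide
  · refine ⟨(hcol j).1, ?_, hM1.1.isTwoMatchingSet_union (hcol j).1, (hcol j).2⟩
    rw [Finset.coe_union]
    exact Set.union_subset hM1G
      ((Finset.coe_subset.2 (Finset.filter_subset _ _)).trans hCG)
end

section
/- Let K be the complete graph on a finite vertex set with n ≥ 3 vertices, let M1 be a matching of K, and let P be an acyclic 2-matching of K such that no edge of M1 is an edge of P. Then there exists a Hamiltonian path H of K such that every edge of P is an edge of H and no edge of M1 is an edge of H. -/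
namespace SimpleGraph

/-- In a finite graph, every vertex lies on a path that cannot be extended at either end. -/
theorem exists_isPath_mem_support_of_maximal {V : Type*} [Finite V] (G : SimpleGraph V) (u : V) :
    ∃ (a b : V) (p : G.Walk a b), p.IsPath ∧ u ∈ p.support ∧
      (∀ c, G.Adj a c → c ∈ p.support) ∧ (∀ c, G.Adj b c → c ∈ p.support) := by
  classical
  have := Fintype.ofFinite V
  let S : Set ℕ := {n | ∃ (a b : V) (p : G.Walk a b), p.IsPath ∧ u ∈ p.support ∧ p.length = n}
  have hS : S.Finite := by
    refine (Set.finite_lt_nat (Fintype.card V)).subset ?_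
    rintro n ⟨a, b, p, hp, -, rfl⟩
    exact hp.length_lt
  obtain ⟨n, -, ⟨a, b, p, hp, hu, rfl⟩, hmax⟩ :=
    hS.exists_le_maximal (a := 0) ⟨u, u, .nil, by simp, by simp, rfl⟩
  refine ⟨a, b, p, hp, hu, fun c hc ↦ ?_, fun c hc ↦ ?_⟩ <;> by_contra hcp
  · have := hmax (y := p.length + 1) ⟨c, b, .cons hc.symm p, hp.cons hcp, by simp [hu], by simp⟩
    simp at this
  · have := hmax (y := p.length + 1)
      ⟨a, c, p.concat hc, (Walk.concat_isPath_iff hc).2 ⟨hp, hcp⟩,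
        by simp [Walk.support_concat, hu], by simp⟩
    simp at this

/-- In a finite acyclic graph, every vertex lies on a path both of whose ends have at most one
neighbor. -/
theorem IsAcyclic.exists_isPath_mem_support_subsingleton_neighborSet {V : Type*} [Finite V]
    {G : SimpleGraph V} (hG : G.IsAcyclic) (u : V) :
    ∃ (a b : V) (p : G.Walk a b), p.IsPath ∧ u ∈ p.support ∧
      (G.neighborSet a).Subsingleton ∧ (G.neighborSet b).Subsingleton := by
  obtain ⟨a, b, p, hp, hu, ha, hb⟩ := G.exists_isPath_mem_support_of_maximal u
  refine ⟨a, b, p, hp, hu, fun c hc d hd ↦ ?_, fun c hc d hd ↦ ?_⟩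
  · rw [hG.eq_snd_of_adj_start hp hc (ha c hc), hG.eq_snd_of_adj_start hp hd (ha d hd)]
  · rw [hG.eq_penultimate_of_adj_end hp hc (hb c hc), hG.eq_penultimate_of_adj_end hp hd (hb d hd)]

/-- In an acyclic graph, an edge between two vertices of a walk is an edge of that walk. -/
theorem IsAcyclic.mem_edges_of_mem_support {V : Type*} {G : SimpleGraph V}
    (hG : G.IsAcyclic) {a b x y : V} (p : G.Walk a b) (hx : x ∈ p.support) (hy : y ∈ p.support)
    (h : G.Adj x y) : s(x, y) ∈ p.edges := by
  classical
  have := isBridge_iff_forall_walk_mem_edges.1 (isAcyclic_iff_forall_adj_isBridge.1 hG h)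
    ((p.takeUntil x hx).reverse.append (p.takeUntil y hy))
  rw [Walk.edges_append, Walk.edges_reverse, List.mem_append, List.mem_reverse] at this
  exact this.elim (p.edges_takeUntil_subset_edges hx ·) (p.edges_takeUntil_subset_edges hy ·)

/-- A finite connected graph with all degrees at most two has a Hamiltonian path. -/
theorem Connected.exists_isHamiltonian_of_ncard_neighborSet_le_two {V : Type*} [Finite V]
    [DecidableEq V] {G : SimpleGraph V} (hG : G.Connected)
    (hdeg : ∀ v, (G.neighborSet v).ncard ≤ 2) :
    ∃ (a b : V) (p : G.Walk a b), p.IsHamiltonian := by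
  obtain ⟨u⟩ := hG.nonempty
  obtain ⟨a, b, p, hp, -, ha, hb⟩ := G.exists_isPath_mem_support_of_maximal u
  refine ⟨a, b, p, hp.isHamiltonian_of_mem fun w ↦ ?_⟩
  by_contra hw
  obtain ⟨q⟩ := hG.preconnected a w
  obtain ⟨⟨⟨x, y⟩, hxy⟩, -, hx, hy⟩ := q.exists_boundary_dart {v | v ∈ p.support} (by simp) hw
  simp only [Set.mem_ofPred_eq] at hx hy
  obtain ⟨i, rfl, hi⟩ := Walk.mem_support_iff_exists_getVert.1 hx
  have h0 : i ≠ 0 := by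
    rintro rfl
    exact hy (ha y (by simpa using hxy))
  have h1 : i ≠ p.length := by
    rintro rfl
    exact hy (hb y (by simpa using hxy))
  have h2 := hp.ncard_neighborSet_toSubgraph_internal_eq_two h0 (by omega)
  have h3 := Set.eq_of_subset_of_ncard_le (p.toSubgraph.neighborSet_subset (p.getVert i))
    (h2 ▸ hdeg _) (Set.toFinite _)
  have h4 : y ∈ p.toSubgraph.neighborSet (p.getVert i) := h3 ▸ hxy
  exact hy ((p.mem_verts_toSubgraph).1 (p.toSubgraph.edge_vert h4.symm))

end SimpleGraph

section EdgeSets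

variable {V : Type*} [DecidableEq V] {Q : Finset (Sym2 V)}

/-- The edges of a finite set at a vertex correspond to its neighbors. -/
theorem ncard_neighborSet_fromEdgeSet (hQ : ∀ e ∈ Q, ¬ e.IsDiag) (v : V) :
    ((SimpleGraph.fromEdgeSet (Q : Set (Sym2 V))).neighborSet v).ncard =
      (Q.filter (fun e => v ∈ e)).card := by
  rw [← Set.ncard_coe_finset,
    ← Set.ncard_image_of_injective _ (fun _ _ h ↦ Sym2.congr_right.1 h : (s(v, ·)).Injective)]
  congr 1
  ext e
  simp only [Set.mem_image, SimpleGraph.mem_neighborSet, SimpleGraph.fromEdgeSet_adj,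
    Finset.coe_filter, Set.mem_ofPred_eq, Finset.mem_coe]
  constructor
  · rintro ⟨w, ⟨h, -⟩, rfl⟩
    exact ⟨h, Sym2.mem_mk_left v w⟩
  · rintro ⟨he, w, rfl⟩
    exact ⟨w, ⟨he, fun h ↦ hQ _ he h⟩, rfl⟩

/-- Joining ends of two different components of an acyclic 2-matching gives an acyclic
2-matching. -/
theorem IsAcyclicTwoMatchingSet.insert (hQ : IsAcyclicTwoMatchingSet Q) {x y : V}
    (hxy : ¬ (SimpleGraph.fromEdgeSet (Q : Set (Sym2 V))).Reachable x y)
    (hx : (Q.filter (fun e => x ∈ e)).card ≤ 1) (hy : (Q.filter (fun e => y ∈ e)).card ≤ 1) :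
    IsAcyclicTwoMatchingSet (insert s(x, y) Q) := by
  refine ⟨⟨?_, fun v ↦ ?_⟩, ?_⟩
  · intro e he
    obtain rfl | he := Finset.mem_insert.1 he
    · rintro h
      obtain rfl : x = y := h
      exact hxy .rfl
    · exact hQ.1.1 e he
  · rw [Finset.filter_insert]
    split_ifs with h
    · refine (Finset.card_insert_le _ _).trans ?_
      obtain rfl | rfl := Sym2.mem_iff.1 h <;> omega
    · exact hQ.1.2 v
  · have := hQ.2.sup_edge_of_not_reachable hxy
    rwa [SimpleGraph.edge, ← SimpleGraph.fromEdgeSet_union, Set.union_comm, ← Set.insert_eq,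
      ← Finset.coe_insert] at this

/-- If an acyclic 2-matching is maximal among those avoiding a matching, then vertices in different
components are joined by an edge of the matching. -/
theorem IsMatchingSet.mem_of_not_reachable_of_maximal [Finite V] {M : Finset (Sym2 V)}
    (hM : IsMatchingSet M)
    (hQ : Maximal (fun R ↦ IsAcyclicTwoMatchingSet R ∧ Disjoint M R) Q) {u w : V}
    (huw : ¬ (SimpleGraph.fromEdgeSet (Q : Set (Sym2 V))).Reachable u w) : s(u, w) ∈ M := by
  set G := SimpleGraph.fromEdgeSet (Q : Set (Sym2 V))
  have key : ∀ x y, (G.neighborSet x).Subsingleton → (G.neighborSet y).Subsingleton →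
      ¬ G.Reachable x y → s(x, y) ∈ M := by
    intro x y hx hy hxy
    by_contra hxyM
    rw [← Set.ncard_le_one_iff_subsingleton, ncard_neighborSet_fromEdgeSet hQ.prop.1.1.1] at hx hy
    have hins : s(x, y) ∈ Q := hQ.le_of_ge
      ⟨hQ.prop.1.insert hxy hx hy, Finset.disjoint_insert_right.2 ⟨hxyM, hQ.prop.2⟩⟩
      (Finset.subset_insert _ _) (Finset.mem_insert_self _ _)
    have hne : x ≠ y := by
      rintro rfl
      exact hxy .rfl
    exact hxy (SimpleGraph.Adj.reachable ((SimpleGraph.fromEdgeSet_adj _).2 ⟨hins, hne⟩))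
  have partner : ∀ x y z, s(x, y) ∈ M → s(x, z) ∈ M → y = z := by
    intro x y z hy hz
    by_contra hyz
    exact hM.2 _ hy _ hz (fun h ↦ hyz (Sym2.congr_right.1 h)) x (Sym2.mem_mk_left x y)
      (Sym2.mem_mk_left x z)
  obtain ⟨a, b, p, hp, hu, ha, hb⟩ :=
    hQ.prop.1.2.exists_isPath_mem_support_subsingleton_neighborSet u
  obtain ⟨c, d, q, hq, hw, hc, hd⟩ :=
    hQ.prop.1.2.exists_isPath_mem_support_subsingleton_neighborSet w
  have hau : G.Reachable a u := ⟨p.takeUntil u hu⟩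
  have hub : G.Reachable u b := ⟨p.dropUntil u hu⟩
  have hcw : G.Reachable c w := ⟨q.takeUntil w hw⟩
  have hwd : G.Reachable w d := ⟨q.dropUntil w hw⟩
  have hac := key a c ha hc fun h ↦ huw (hau.symm.trans (h.trans hcw))
  have had := key a d ha hd fun h ↦ huw (hau.symm.trans (h.trans hwd.symm))
  have hbc := key b c hb hc fun h ↦ huw (hub.trans (h.trans hcw))
  obtain rfl := partner a c d hac had
  obtain rfl := partner c a b (Sym2.eq_swap ▸ hac) (Sym2.eq_swap ▸ hbc)
  rw [(SimpleGraph.Walk.isPath_iff_nil.1 hp).eq_nil] at hu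
  rw [(SimpleGraph.Walk.isPath_iff_nil.1 hq).eq_nil] at hw
  obtain rfl : u = a := by simpa using hu
  obtain rfl : w = c := by simpa using hw
  exact hac

end EdgeSets

/-- In the complete graph on a finite vertex set with at least 3 vertices,
if `M1` is a matching and `P` is an acyclic 2-matching sharing no edge with `M1`, then
there is a Hamiltonian path of the complete graph whose edges include every edge of `P`
and exclude every edge of `M1`. -/
theorem stmt7 {V : Type*} [Fintype V] [DecidableEq V]
    (hV : 3 ≤ Fintype.card V)
    (M1 : Finset (Sym2 V)) (hM1 : IsMatchingSet M1)
    (P : Finset (Sym2 V)) (hP : IsAcyclicTwoMatchingSet P)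
    (hdisj : Disjoint M1 P) :
    ∃ (a b : V) (p : (⊤ : SimpleGraph V).Walk a b),
      p.IsHamiltonian ∧ (∀ e ∈ P, e ∈ p.edges) ∧ ∀ e ∈ M1, e ∉ p.edges := by
  classical
  obtain ⟨Q, hPQ, hQ⟩ := Finite.exists_le_maximal
    (p := fun R ↦ IsAcyclicTwoMatchingSet R ∧ Disjoint M1 R) ⟨hP, hdisj⟩
  obtain ⟨⟨hQ2, hQa⟩, hQd⟩ := hQ.prop
  set G := SimpleGraph.fromEdgeSet (Q : Set (Sym2 V)) with hG
  have hpre : G.Preconnected := by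
    intro u w
    by_contra huw
    have huwM := hM1.mem_of_not_reachable_of_maximal hQ huw
    obtain ⟨z, hz⟩ : ∃ z, z ∉ ({u, w} : Finset V) := by
      by_contra! h
      have := Finset.card_le_card (fun z _ ↦ h z : Finset.univ ⊆ {u, w})
      have := Finset.card_le_two (a := u) (b := w)
      rw [Finset.card_univ] at *
      omega
    simp only [Finset.mem_insert, Finset.mem_singleton, not_or] at hz
    by_cases huz : G.Reachable u z
    · have hwzM := hM1.mem_of_not_reachable_of_maximal hQ fun h : G.Reachable w z ↦
        huw (huz.trans h.symm)
      refine hM1.2 _ huwM _ hwzM (fun h ↦ ?_) w (Sym2.mem_mk_right u w) (Sym2.mem_mk_left w z)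
      rw [Sym2.eq_swap] at h
      exact hz.1 (Sym2.congr_right.1 h).symm
    · have huzM := hM1.mem_of_not_reachable_of_maximal hQ huz
      exact hM1.2 _ huwM _ huzM (fun h ↦ hz.2 (Sym2.congr_right.1 h).symm) u
        (Sym2.mem_mk_left u w) (Sym2.mem_mk_left u z)
  have : Nonempty V := Fintype.card_pos_iff.1 (by omega)
  obtain ⟨a, b, p, hp⟩ :=
    SimpleGraph.Connected.exists_isHamiltonian_of_ncard_neighborSet_le_two ⟨hpre⟩ fun v ↦
      (ncard_neighborSet_fromEdgeSet hQ2.1 v).trans_le (hQ2.2 v)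
  refine ⟨a, b, p.mapLe le_top, ?_, fun e he ↦ ?_, fun e he hep ↦ ?_⟩
  · intro v
    rw [SimpleGraph.Walk.support_mapLe_eq_support]
    exact hp v
  · rw [SimpleGraph.Walk.edges_mapLe_eq_edges]
    induction e with | _ x y =>
    exact hQa.mem_edges_of_mem_support p (hp.mem_support x) (hp.mem_support y)
      ((SimpleGraph.fromEdgeSet_adj _).2 ⟨hPQ he, fun h ↦ hQ2.1 _ (hPQ he) h⟩)
  · rw [SimpleGraph.Walk.edges_mapLe_eq_edges] at hep
    have := p.edges_subset_edgeSet hep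
    rw [hG, SimpleGraph.edgeSet_fromEdgeSet] at this
    exact Finset.disjoint_left.1 hQd he this.1
end
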